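/- Fix an integer d ≥ 2. For every polynomial Φ in 2(2d+2) variables, bihomogeneous in the two groups of 2d+2 variables, that does not vanish at every pair of coefficient tuples defining a pair of rational maps of degree d on ℙ¹(ℂ), there exist rational maps f and g of degree d on ℙ¹(ℂ) whose pair of coefficient tuples is a nonzero point of Φ and such that Preper(f) ∩ Preper(g) contains at least 4d − 1 distinct points. Equivalently, the set of pairs of degree-d rational maps sharing at least 4d − 1 distinct preperiodic points is Zariski dense in the space of all pairs. -/

import Mathlib

noncomputable section

open MvPolynomial

abbrev P1 : Type := Projectivization ℂ (Fin 2 → ℂ)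

lemma vec_ne {p q : ℂ} (h : p ≠ 0 ∨ q ≠ 0) : ![p, q] ≠ 0 := by
  intro hz
  rcases h with h | h
  · exact h (by simpa using congrFun hz 0)
  · exact h (by simpa using congrFun hz 1)

/-- Evaluation at `v ∈ ℂ²` of the homogeneous degree-`d` form `∑ⱼ aⱼ Xʲ Y^(d-j)`
whose coefficient tuple is `a`. -/
def homEval {d : ℕ} (a : Fin (d + 1) → ℂ) (v : Fin 2 → ℂ) : ℂ :=
  ∑ j : Fin (d + 1), a j * v 0 ^ (j : ℕ) * v 1 ^ (d - (j : ℕ))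

/-- The pair of degree-`d` forms with coefficient tuples `a`, `b` has no common zero
in `ℂ² \ {0}`. -/
def GoodPair {d : ℕ} (a b : Fin (d + 1) → ℂ) : Prop :=
  ∀ v : Fin 2 → ℂ, v ≠ 0 → homEval a v ≠ 0 ∨ homEval b v ≠ 0

open Classical in
/-- The self-map of `ℙ¹(ℂ)` induced by the pair of degree-`d` forms with coefficient
tuples `a`, `b` (defined arbitrarily where both forms vanish, which does not happen
for a `GoodPair`). -/
def ratFun {d : ℕ} (a b : Fin (d + 1) → ℂ) (x : P1) : P1 :=
  if h : homEval a x.rep ≠ 0 ∨ homEval b x.rep ≠ 0 then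
    Projectivization.mk ℂ ![homEval a x.rep, homEval b x.rep] (vec_ne h)
  else x

/-- A rational map of degree `d` on `ℙ¹(ℂ)`: a pair of homogeneous degree-`d` forms
(recorded through their coefficient tuples) with no common zero in `ℂ² \ {0}`. -/
structure RatMap (d : ℕ) where
  a : Fin (d + 1) → ℂ
  b : Fin (d + 1) → ℂ
  good : GoodPair a b

/-- The self-map of `ℙ¹(ℂ)` induced by a rational map. -/
def RatMap.toFun {d : ℕ} (f : RatMap d) : P1 → P1 := ratFun f.a f.b

/-- The set of preperiodic points of a rational map of degree `d` on `ℙ¹(ℂ)`. -/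
def Preper {d : ℕ} (f : RatMap d) : Set P1 :=
  {x | ∃ n m : ℕ, m < n ∧ f.toFun^[n] x = f.toFun^[m] x}

/-- The point `[z : 1]` of `ℙ¹(ℂ)`. -/
def toP1 (z : ℂ) : P1 := Projectivization.mk ℂ ![z, 1] (vec_ne (Or.inr one_ne_zero))

/-- The point `∞ = [1 : 0]` of `ℙ¹(ℂ)`. -/
def infty : P1 := Projectivization.mk ℂ ![1, 0] (vec_ne (Or.inl one_ne_zero))

/-- The Möbius transformation of `ℙ¹(ℂ)` induced by an invertible linear map of `ℂ²`. -/
def mobius (M : (Fin 2 → ℂ) ≃ₗ[ℂ] (Fin 2 → ℂ)) (x : P1) : P1 :=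
  Projectivization.mk ℂ (M x.rep) (by
    simpa using (LinearEquiv.map_ne_zero_iff M).mpr x.rep_nonzero)

/-- Bihomogeneity of a polynomial in the `2(2d+2)` variables indexed by
`Fin 2 × Fin 2 × Fin (d+1)` (the first factor indexing the two groups of `2d+2`
coefficient-variables of a pair of rational maps): every monomial has total degree `h₁`
in the first group of variables and `h₂` in the second. -/
def Bihomog {d : ℕ} (Φ : MvPolynomial (Fin 2 × Fin 2 × Fin (d + 1)) ℂ) : Prop :=
  ∃ h₁ h₂ : ℕ, ∀ mo ∈ Φ.support,
    (∑ q : Fin 2 × Fin (d + 1), mo ((0 : Fin 2), q)) = h₁ ∧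
    (∑ q : Fin 2 × Fin (d + 1), mo ((1 : Fin 2), q)) = h₂

/-- The pair of coefficient tuples of the pair `(f, g)` of rational maps of degree `d`,
as a point of `ℂ^(2(2d+2))`. -/
def pairCoeffs {d : ℕ} (f g : RatMap d) : Fin 2 × Fin 2 × Fin (d + 1) → ℂ :=
  fun q =>
    if q.1 = 0 then (if q.2.1 = 0 then f.a q.2.2 else f.b q.2.2)
    else (if q.2.1 = 0 then g.a q.2.2 else g.b q.2.2)

open scoped Topology

abbrev CV (d : ℕ) : Type := Fin 2 × Fin (d + 1) → ℂ

def q0 (d : ℕ) (c : Circle) : CV d := fun x =>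
  if x.1 = 0 then (if x.2 = Fin.last d then (c : ℂ) else 0) else (if x.2 = 0 then 1 else 0)

def Tm (d : ℕ) (c : Circle) : C(Circle, Circle) := ⟨fun z => c * z ^ d, by fun_prop⟩

def Sm (d : ℕ) (c : Circle) : C(Circle, ℂ) →L[ℂ] C(Circle, ℂ) :=
  LinearMap.mkContinuous
    { toFun := fun h => h.comp (Tm d c)
      map_add' := fun _ _ => rfl
      map_smul' := fun _ _ => rfl } 1 (by
    intro h
    rw [one_mul, ContinuousMap.norm_le _ (norm_nonneg _)]
    intro z
    exact h.norm_coe_le_norm _)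

@[simp] lemma Sm_apply (d : ℕ) (c z : Circle) (h : C(Circle, ℂ)) :
    Sm d c h z = h (c * z ^ d) := rfl

def idC : C(Circle, ℂ) := ⟨fun z => (z : ℂ), by fun_prop⟩

@[simp] lemma idC_apply (z : Circle) : idC z = (z : ℂ) := rfl

def Th (d : ℕ) (c : Circle) (x : CV d × C(Circle, ℂ)) : C(Circle, ℂ) :=
  (∑ j : Fin (d + 1), x.1 (0, j) • x.2 ^ (j : ℕ)) -
    (∑ j : Fin (d + 1), x.1 (1, j) • x.2 ^ (j : ℕ)) * Sm d c x.2

lemma Th_apply (d : ℕ) (c : Circle) (q : CV d) (h : C(Circle, ℂ)) (z : Circle) :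
    Th d c (q, h) z = (∑ j : Fin (d + 1), q (0, j) * h z ^ (j : ℕ)) -
    (∑ j : Fin (d + 1), q (1, j) * h z ^ (j : ℕ)) * h (c * z ^ d) := by
  simp [Th, ContinuousMap.sum_apply]

lemma Th_q0 (d : ℕ) (c : Circle) : Th d c (q0 d c, idC) = 0 := by
  ext z
  rw [Th_apply]
  simp [q0, ite_mul, Finset.sum_ite_eq']

lemma Th_deriv (d : ℕ) (c : Circle) : ∃ f' : CV d × C(Circle, ℂ) →L[ℂ] C(Circle, ℂ),
    HasStrictFDerivAt (Th d c) f' (q0 d c, idC) ∧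
    ∀ δ v z, f' (δ, v) z = (∑ j : Fin (d + 1), δ (0, j) * (z : ℂ) ^ (j : ℕ)) -
      (∑ j : Fin (d + 1), δ (1, j) * (z : ℂ) ^ (j : ℕ)) * (c * (z : ℂ) ^ d)
      + (c * d * (z : ℂ) ^ (d - 1) * v z - v (c * z ^ d)) := by
  set x0 : CV d × C(Circle, ℂ) := (q0 d c, idC)
  have hsnd : HasStrictFDerivAt (fun x : CV d × C(Circle, ℂ) => x.2)
    (ContinuousLinearMap.snd ℂ (CV d) C(Circle, ℂ)) x0 := hasStrictFDerivAt_snd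
  have hco : ∀ i, HasStrictFDerivAt (fun x : CV d × C(Circle, ℂ) => x.1 i)
    ((ContinuousLinearMap.proj i).comp (ContinuousLinearMap.fst ℂ (CV d) C(Circle, ℂ))) x0 :=
    fun i => ((ContinuousLinearMap.proj i).comp
      (ContinuousLinearMap.fst ℂ (CV d) C(Circle, ℂ))).hasStrictFDerivAt
  have hS : HasStrictFDerivAt (fun x : CV d × C(Circle, ℂ) => Sm d c x.2)
    ((Sm d c).comp (ContinuousLinearMap.snd ℂ (CV d) C(Circle, ℂ))) x0 :=
    ((Sm d c).comp (ContinuousLinearMap.snd ℂ (CV d) C(Circle, ℂ))).hasStrictFDerivAt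
  have h1 := fun k : Fin 2 => HasStrictFDerivAt.fun_sum (u := Finset.univ)
    (fun (j : Fin (d+1)) _ => (hco (k, j)).smul (hsnd.pow (j : ℕ)))
  have h2 := (h1 0).sub ((h1 1).mul hS)
  refine ⟨_, h2, ?_⟩
  intro δ v z
  simp [x0, q0, ContinuousMap.sum_apply, Finset.sum_add_distrib]
  ring

lemma inv_lemma (d : ℕ) (hd : 2 ≤ d) (c : Circle) (L : C(Circle, ℂ) →L[ℂ] C(Circle, ℂ))
    (hL : ∀ v z, L v z = c * d * (z : ℂ) ^ (d - 1) * v z - v (c * z ^ d)) : L.IsInvertible := by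
  have hd0 : (d : ℂ) ≠ 0 := by
    have : d ≠ 0 := by omega
    exact_mod_cast this
  let m : C(Circle, ℂ) := ⟨fun z => c * d * (z : ℂ) ^ (d - 1), by fun_prop⟩
  let mi : C(Circle, ℂ) := ⟨fun z => (d : ℂ)⁻¹ * (c⁻¹ : Circle) * ((z⁻¹ : Circle) : ℂ) ^ (d - 1), by fun_prop⟩
  have hmm : m * mi = 1 := by
    ext z
    have h1 := Circle.coe_ne_zero z
    have h2 := Circle.coe_ne_zero c
    simp [m, mi]
    field_simp
  let M : C(Circle, ℂ) →L[ℂ] C(Circle, ℂ) := ContinuousLinearMap.mul ℂ _ m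
  let Mi : C(Circle, ℂ) →L[ℂ] C(Circle, ℂ) := ContinuousLinearMap.mul ℂ _ mi
  have hMMi : M * Mi = 1 := by
    ext1 v; show m * (mi * v) = v; rw [← mul_assoc, hmm, one_mul]
  have hMiM : Mi * M = 1 := by
    ext1 v; show mi * (m * v) = v; rw [← mul_assoc, mul_comm mi, hmm, one_mul]
  have hnorm : ‖Mi * Sm d c‖ < 1 := by
    have : ‖Mi * Sm d c‖ ≤ 1 / 2 := by
      refine ContinuousLinearMap.opNorm_le_bound _ (by norm_num) fun v => ?_
      rw [ContinuousMap.norm_le _ (by positivity)]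
      intro z
      show ‖mi z * v (c * z ^ d)‖ ≤ _
      rw [norm_mul]
      have h1 : ‖mi z‖ = (d : ℝ)⁻¹ := by simp [mi, Circle.norm_coe]
      rw [h1]
      have h2 := v.norm_coe_le_norm (c * z ^ d)
      have h3 : (d : ℝ)⁻¹ ≤ 1 / 2 := by
        rw [one_div]; gcongr; exact_mod_cast hd
      gcongr
    linarith
  have hu : IsUnit (1 - Mi * Sm d c) := by
    have := (Units.oneSub (Mi * Sm d c) hnorm).isUnit
    rwa [Units.val_oneSub] at this
  have hM : IsUnit M := ⟨⟨M, Mi, hMMi, hMiM⟩, rfl⟩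
  have hLe : L = M * (1 - Mi * Sm d c) := by
    rw [mul_sub, mul_one, ← mul_assoc, hMMi, one_mul]
    ext v z
    rw [hL]; rfl
  obtain ⟨U, hU⟩ := hLe ▸ hM.mul hu
  exact ⟨ContinuousLinearEquiv.unitsEquiv ℂ _ U, by rw [← hU]; rfl⟩

theorem conj_exists (d : ℕ) (hd : 2 ≤ d) (c : Circle) :
    ∃ (ψ : CV d → C(Circle, ℂ)) (D : CV d →L[ℂ] C(Circle, ℂ)),
      HasStrictFDerivAt ψ D (q0 d c) ∧ ψ (q0 d c) = idC ∧
      (∀ᶠ q in 𝓝 (q0 d c), ∀ z : Circle, (∑ j : Fin (d + 1), q (0, j) * ψ q z ^ (j : ℕ)) =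
        (∑ j : Fin (d + 1), q (1, j) * ψ q z ^ (j : ℕ)) * ψ q (c * z ^ d)) ∧
      ∀ δ z, D δ (c * z ^ d) - c * d * (z : ℂ) ^ (d - 1) * D δ z =
        (∑ j : Fin (d + 1), δ (0, j) * (z : ℂ) ^ (j : ℕ)) -
        (∑ j : Fin (d + 1), δ (1, j) * (z : ℂ) ^ (j : ℕ)) * (c * (z : ℂ) ^ d) := by
  obtain ⟨f', hf, hf'⟩ := Th_deriv d c
  have hinv : (f' ∘L .inr ℂ (CV d) C(Circle, ℂ)).IsInvertible := by
    apply inv_lemma d hd c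
    intro v z
    show f' (0, v) z = _
    rw [hf']; simp
  have hD := hf.hasStrictFDerivAt_implicitFunctionOfProdDomain hinv
  have hev := hf.eventually_apply_implicitFunctionOfProdDomain hinv
  have hid := (hf.eventually_apply_eq_iff_implicitFunctionOfProdDomain hinv).self_of_nhds.mp rfl
  set ψ := hf.implicitFunctionOfProdDomain hinv
  refine ⟨ψ, _, hD, hid, ?_, ?_⟩
  · filter_upwards [hev] with q hq z
    rw [Th_q0] at hq
    have := Th_apply d c q (ψ q) z
    rw [hq] at this
    exact (sub_eq_zero.mp this.symm)
  · intro δ z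
    set D := (-(f' ∘L .inr ℂ (CV d) C(Circle, ℂ)).inverse ∘L (f' ∘L .inl ℂ (CV d) C(Circle, ℂ)))
    have h0 : f' (δ, D δ) = 0 := by
      have e1 : f' (δ, D δ) = (f' ∘L .inl ℂ (CV d) C(Circle, ℂ)) δ +
          (f' ∘L .inr ℂ (CV d) C(Circle, ℂ)) (D δ) := by
        simp only [ContinuousLinearMap.comp_apply]
        rw [← map_add]; simp
      rw [e1]
      have e2 : D δ = -((f' ∘L .inr ℂ (CV d) C(Circle, ℂ)).inverse
        ((f' ∘L .inl ℂ (CV d) C(Circle, ℂ)) δ)) := rfl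
      rw [e2, map_neg, hinv.self_apply_inverse, add_neg_cancel]
    have := hf' δ (D δ) z
    rw [h0] at this
    simp only [ContinuousMap.zero_apply] at this
    linear_combination this

lemma exp_pow (x : ℝ) (n : ℕ) : Circle.exp x ^ n = Circle.exp (n * x) := by
  induction n with
  | zero => simp
  | succ n ih => rw [pow_succ, ih, ← Circle.exp_add]; congr 1; push_cast; ring

lemma orderOf_exp (n : ℕ) (hn : 0 < n) : orderOf (Circle.exp (2 * Real.pi / n)) = n := by
  have hp := Complex.isPrimitiveRoot_exp n hn.ne'
  have : ((Circle.exp (2 * Real.pi / n) : Circle) : ℂ) = Complex.exp (2 * Real.pi * Complex.I / n) := by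
    rw [Circle.coe_exp]; congr 1; push_cast; ring
  rw [← this] at hp
  have h2 := hp.eq_orderOf
  rw [← orderOf_injective Circle.coeHom Circle.coe_injective]
  exact h2.symm

lemma finOrder_infinite : Set.Infinite {z : ℂ | ∃ w : Circle, IsOfFinOrder w ∧ (w : ℂ) = z} := by
  refine Set.infinite_of_injective_forall_mem
    (f := fun n : ℕ => ((Circle.exp (2 * Real.pi / ((n + 1 : ℕ) : ℝ)) : Circle) : ℂ)) ?_ ?_
  · intro m n h
    have h1 : Circle.exp (2 * Real.pi / ((m + 1 : ℕ) : ℝ)) = Circle.exp (2 * Real.pi / ((n + 1 : ℕ) : ℝ)) :=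
      Circle.coe_injective h
    have h2 := congrArg orderOf h1
    rw [orderOf_exp (m + 1) (Nat.add_one_pos _), orderOf_exp (n + 1) (Nat.add_one_pos _)] at h2
    omega
  · intro n
    refine ⟨_, ?_, rfl⟩
    rw [← orderOf_pos_iff, orderOf_exp _ (Nat.add_one_pos _)]
    exact Nat.add_one_pos _

lemma poly_zero (P : Polynomial ℂ) (h : ∀ w : Circle, IsOfFinOrder w → P.eval (w : ℂ) = 0) :
    P = 0 := by
  apply Polynomial.eq_zero_of_infinite_isRoot
  refine finOrder_infinite.mono ?_
  rintro z ⟨w, hw, rfl⟩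
  exact h w hw

lemma exists_root (d : ℕ) (hd : 0 < d) (y : Circle) (hy : IsOfFinOrder y) :
    ∃ z : Circle, IsOfFinOrder z ∧ z ^ d = y := by
  refine ⟨Circle.exp (Complex.arg y / d), ?_, ?_⟩
  · have : Circle.exp (Complex.arg y / d) ^ d = y := by
      rw [exp_pow, mul_div_cancel₀ _ (by positivity), Circle.exp_arg]
    rw [← this] at hy
    exact (isOfFinOrder_pow.mp hy).resolve_right hd.ne'
  · rw [exp_pow, mul_div_cancel₀ _ (by positivity), Circle.exp_arg]

lemma ker_poly (d : ℕ) (hd : 2 ≤ d) (c : Circle) (hc : orderOf c = d + 1) (u : Circle → ℂ)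
    (F G : Polynomial ℂ) (hF : F.natDegree ≤ 2 * d) (hG : G.natDegree ≤ 2 * d)
    (H1 : ∀ z : Circle, IsOfFinOrder z → (z : ℂ) ^ d * (u (z ^ d) - d * u z) = F.eval (z : ℂ))
    (H2 : ∀ z : Circle, IsOfFinOrder z → (z : ℂ) ^ d * (u (c * z ^ d) - d * u z) = G.eval (z : ℂ))
    (g1 : G.coeff (d - 1) = 0) (g2 : G.coeff d = 0) (g3 : G.coeff (d + 1) = 0) :
    F = 0 ∧ G = 0 := by
  have hcf : IsOfFinOrder c := by rw [← orderOf_pos_iff, hc]; omega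
  have hc0 : (c : ℂ) ≠ 0 := Circle.coe_ne_zero c
  have hd0 : (d : ℂ) ≠ 0 := by
    have : d ≠ 0 := by omega
    exact_mod_cast this
  -- roots
  set R : Polynomial ℂ := G - F with hR
  have hRdeg : R.natDegree ≤ 2 * d := (Polynomial.natDegree_sub_le _ _).trans (max_le hG hF)
  have hRe : ∀ z : Circle, IsOfFinOrder z →
      (z : ℂ) ^ d * (u (c * z ^ d) - u (z ^ d)) = R.eval (z : ℂ) := by
    intro z hz
    rw [hR, Polynomial.eval_sub, ← H1 z hz, ← H2 z hz]; ring
  set w : Circle := Circle.exp (2 * Real.pi / d)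
  have hw : orderOf w = d := orderOf_exp d (by omega)
  have hwf : IsOfFinOrder w := by rw [← orderOf_pos_iff, hw]; omega
  have hwd : w ^ d = 1 := by rw [← hw]; exact pow_orderOf_eq_one w
  have hcomp : R.comp (Polynomial.C (w : ℂ) * Polynomial.X) - R = 0 := by
    apply poly_zero
    intro z hz
    have h1 := hRe z hz
    have h2 := hRe (w * z) (hwf.mul hz)
    rw [mul_pow, hwd, one_mul] at h2
    have h3 : ((w * z : Circle) : ℂ) ^ d = (z : ℂ) ^ d := by
      rw [← Circle.coe_pow, mul_pow, hwd, one_mul, Circle.coe_pow]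
    rw [h3] at h2
    simp only [Polynomial.eval_sub, Polynomial.eval_comp, Polynomial.eval_mul, Polynomial.eval_C,
      Polynomial.eval_X]
    rw [← h1, ← Circle.coe_mul, ← h2]; ring
  have hRc : ∀ n, ¬ d ∣ n → R.coeff n = 0 := by
    intro n hn
    have := congrArg (fun P => Polynomial.coeff P n) hcomp
    simp only [Polynomial.coeff_sub, Polynomial.comp_C_mul_X_coeff, Polynomial.coeff_zero] at this
    have h2 : R.coeff n * ((w : ℂ) ^ n - 1) = 0 := by linear_combination this
    rcases mul_eq_zero.mp h2 with h | h
    · exact h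
    · exfalso
      apply hn
      rw [← hw]
      apply orderOf_dvd_of_pow_eq_one
      apply Circle.coe_injective
      rw [Circle.coe_pow, Circle.coe_one]
      exact sub_eq_zero.mp h
  set A := R.coeff (2 * d)
  set B := R.coeff d
  set C := R.coeff 0
  have hRform : R = Polynomial.C A * Polynomial.X ^ (2 * d) + Polynomial.C B * Polynomial.X ^ d
      + Polynomial.C C := by
    ext n
    simp only [Polynomial.coeff_add, Polynomial.coeff_C_mul, Polynomial.coeff_X_pow,
      Polynomial.coeff_C]
    by_cases h0 : n = 0
    · subst h0
      rw [if_neg (by omega), if_neg (by omega), if_pos rfl]; simp [C]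
    by_cases h1 : n = d
    · subst h1
      rw [if_neg (by omega), if_pos (by omega), if_neg (by omega)]; simp [B]
    by_cases h2 : n = 2 * d
    · subst h2
      rw [if_pos (by omega), if_neg (by omega), if_neg (by omega)]; simp [A]
    rw [if_neg h2, if_neg h1, if_neg h0]
    simp only [mul_zero, add_zero]
    by_cases h3 : 2 * d < n
    · exact Polynomial.coeff_eq_zero_of_natDegree_lt (by omega)
    · apply hRc
      rintro ⟨k, hk⟩
      have : k < 3 := by
        by_contra hk3
        have : d * 3 ≤ d * k := Nat.mul_le_mul_left _ (by omega)
        omega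
      interval_cases k <;> omega
  have hstep : ∀ y : Circle, IsOfFinOrder y → u (c * y) - u y = A * y + B + C * (y : ℂ)⁻¹ := by
    intro y hy
    obtain ⟨z, hz, rfl⟩ := exists_root d (by omega) y hy
    have h1 := hRe z hz
    rw [hRform] at h1
    simp only [Polynomial.eval_add, Polynomial.eval_mul, Polynomial.eval_pow, Polynomial.eval_C,
      Polynomial.eval_X] at h1
    have hz0 : (z : ℂ) ^ d ≠ 0 := pow_ne_zero _ (Circle.coe_ne_zero z)
    apply mul_left_cancel₀ hz0
    rw [h1, Circle.coe_pow]
    field_simp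
    ring
  have hiter : ∀ (k : ℕ) (y : Circle), IsOfFinOrder y → u (c ^ k * y) - u y =
      A * (∑ i ∈ Finset.range k, (c : ℂ) ^ i) * y + k * B +
      C * (∑ i ∈ Finset.range k, ((c : ℂ) ^ i)⁻¹) * (y : ℂ)⁻¹ := by
    intro k y hy
    induction k with
    | zero => simp
    | succ k ih =>
      have h1 := hstep (c ^ k * y) (hcf.pow.mul hy)
      rw [← mul_assoc, ← pow_succ'] at h1
      rw [Finset.sum_range_succ, Finset.sum_range_succ]
      rw [Circle.coe_mul, Circle.coe_pow, mul_inv] at h1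
      push_cast
      linear_combination h1 + ih
  set s := ∑ i ∈ Finset.range d, (c : ℂ) ^ i
  set s' := ∑ i ∈ Finset.range d, ((c : ℂ) ^ i)⁻¹
  have key : Polynomial.C (d * A) * Polynomial.X ^ (d + 1) + Polynomial.C (d * C) * Polynomial.X ^ (d - 1)
      + (Polynomial.C ((c : ℂ) ^ d)⁻¹ * F.comp (Polynomial.C (c : ℂ) * Polynomial.X) - F)
      - (Polynomial.C (A * s) * Polynomial.X ^ (2 * d) + Polynomial.C (C * s')) = 0 := by
    apply poly_zero
    intro z hz
    have h1 := hiter d (z ^ d) hz.pow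
    have h2 := H1 z hz
    have h3 := H1 (c * z) (hcf.mul hz)
    have h4 := hstep z hz
    rw [mul_pow] at h3
    simp only [Polynomial.eval_add, Polynomial.eval_sub, Polynomial.eval_mul, Polynomial.eval_pow,
      Polynomial.eval_C, Polynomial.eval_X, Polynomial.eval_comp]
    rw [← Circle.coe_mul, ← h3, ← h2]
    have hz0 : (z : ℂ) ≠ 0 := Circle.coe_ne_zero z
    have e1 : (z : ℂ) ^ (d - 1) = (z : ℂ) ^ d * (z : ℂ)⁻¹ := by
      obtain ⟨e, rfl⟩ : ∃ e, d = e + 1 := ⟨d - 1, by omega⟩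
      rw [Nat.add_sub_cancel, pow_succ, mul_assoc, mul_inv_cancel₀ hz0, mul_one]
    have e2 : ((c * z : Circle) : ℂ) ^ d = (c : ℂ) ^ d * (z : ℂ) ^ d := by
      rw [Circle.coe_mul, mul_pow]
    have hcd : (c : ℂ) ^ d ≠ 0 := pow_ne_zero _ hc0
    have hzd : (z : ℂ) ^ d ≠ 0 := pow_ne_zero _ hz0
    rw [e1, e2]
    rw [Circle.coe_pow] at h1
    have e3 : ((c : ℂ) ^ d)⁻¹ * ((c : ℂ) ^ d * (z : ℂ) ^ d * (u (c ^ d * z ^ d) - d * u (c * z)))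
        = (z : ℂ) ^ d * (u (c ^ d * z ^ d) - d * u (c * z)) := by
      field_simp
    rw [e3]
    have e4 : (z : ℂ) ^ d * ((z : ℂ) ^ d)⁻¹ = 1 := mul_inv_cancel₀ hzd
    have e5 : (z : ℂ) ^ (2 * d) = (z : ℂ) ^ d * (z : ℂ) ^ d := by ring
    rw [e5, pow_succ]
    linear_combination (z : ℂ) ^ d * h1 - d * (z : ℂ) ^ d * h4 + C * s' * e4
  have hcoef : ∀ n, (if n = d + 1 then d * A else 0) + (if n = d - 1 then d * C else 0)
      + F.coeff n * (((c : ℂ) ^ d)⁻¹ * (c : ℂ) ^ n - 1)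
      - ((if n = 2 * d then A * s else 0) + (if n = 0 then C * s' else 0)) = 0 := by
    intro n
    have := congrArg (fun P => Polynomial.coeff P n) key
    simp only [Polynomial.coeff_add, Polynomial.coeff_sub, Polynomial.coeff_C_mul,
      Polynomial.coeff_X_pow, Polynomial.coeff_C, Polynomial.comp_C_mul_X_coeff,
      Polynomial.coeff_zero, mul_ite, mul_one, mul_zero] at this
    linear_combination this
  have hFR : ∀ n, F.coeff n = G.coeff n - R.coeff n := by intro n; rw [hR]; simp
  have ndvd1 : ¬ d ∣ d + 1 := by
    intro h
    have := (Nat.dvd_add_right (dvd_refl d)).mp h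
    have := Nat.le_of_dvd one_pos this
    omega
  have ndvd2 : ¬ d ∣ d - 1 := by
    intro h
    have := Nat.le_of_dvd (by omega) h
    omega
  have hA : A = 0 := by
    have h := hcoef (d + 1)
    rw [hFR, g3, hRc _ ndvd1, if_pos rfl, if_neg (by omega), if_neg (by omega),
      if_neg (by omega)] at h
    simpa [hd0] using h
  have hC : C = 0 := by
    have h := hcoef (d - 1)
    rw [hFR, g1, hRc _ ndvd2, if_pos rfl, if_neg (by omega), if_neg (by omega),
      if_neg (by omega)] at h
    simpa [hd0] using h
  have hB : B = 0 := by
    have h := hiter (d + 1) 1 IsOfFinOrder.one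
    rw [← hc, pow_orderOf_eq_one, hA, hC, hc] at h
    have hd1 : (d : ℂ) + 1 ≠ 0 := by exact_mod_cast Nat.succ_ne_zero d
    simpa [hd1] using h
  have hR0 : R = 0 := by rw [hRform, hA, hB, hC]; simp
  have hF0 : F = 0 := by
    ext n
    rw [Polynomial.coeff_zero]
    by_cases hn : n = d
    · rw [hn, hFR, g2, hR0]; simp
    by_cases hn2 : 2 * d < n
    · exact Polynomial.coeff_eq_zero_of_natDegree_lt (by omega)
    have h := hcoef n
    rw [hA, hC] at h
    simp only [mul_zero, zero_mul, ite_self, zero_add, sub_zero, add_zero] at h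
    rcases mul_eq_zero.mp h with h | h
    · exact h
    exfalso
    have hcd : (c : ℂ) ^ d ≠ 0 := pow_ne_zero _ hc0
    have h2 : (c : ℂ) ^ n = (c : ℂ) ^ d := by
      have h5 := congrArg (fun t => (c : ℂ) ^ d * t) h
      simp only [mul_sub, ← mul_assoc, mul_inv_cancel₀ hcd, one_mul, mul_one, mul_zero] at h5
      exact sub_eq_zero.mp h5
    rw [← Circle.coe_pow, ← Circle.coe_pow] at h2
    have h2' : c ^ n = c ^ d := Circle.coe_injective h2
    have h3 := pow_inj_mod.mp h2'
    rw [hc, Nat.mod_eq_of_lt (by omega : d < d + 1)] at h3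
    by_cases h4 : n < d + 1
    · rw [Nat.mod_eq_of_lt h4] at h3; omega
    · rw [Nat.mod_eq_sub_mod (by omega), Nat.mod_eq_of_lt (by omega)] at h3; omega
  refine ⟨hF0, ?_⟩
  have : G = R + F := by rw [hR]; ring
  rw [this, hR0, hF0, add_zero]

def PA {d : ℕ} (a : Fin (d + 1) → ℂ) : Polynomial ℂ :=
  ∑ j : Fin (d + 1), Polynomial.C (a j) * Polynomial.X ^ (j : ℕ)

lemma PA_eval {d : ℕ} (a : Fin (d + 1) → ℂ) (z : ℂ) :
    (PA a).eval z = ∑ j : Fin (d + 1), a j * z ^ (j : ℕ) := by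
  simp [PA, Polynomial.eval_finsetSum]

lemma PA_coeff_lt {d : ℕ} (a : Fin (d + 1) → ℂ) (n : Fin (d + 1)) :
    (PA a).coeff n = a n := by
  simp only [PA, Polynomial.finsetSum_coeff, Polynomial.coeff_C_mul, Polynomial.coeff_X_pow]
  rw [Finset.sum_eq_single n]
  · simp
  · intro b _ hb
    rw [if_neg (fun h => hb (Fin.ext h.symm)), mul_zero]
  · simp

lemma PA_natDegree {d : ℕ} (a : Fin (d + 1) → ℂ) : (PA a).natDegree ≤ d := by
  apply Polynomial.natDegree_sum_le_of_forall_le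
  intro j _
  exact (Polynomial.natDegree_C_mul_X_pow_le _ _).trans (by have := j.2; omega)

lemma PA_coeff_gt {d : ℕ} (a : Fin (d + 1) → ℂ) (n : ℕ) (hn : d < n) :
    (PA a).coeff n = 0 :=
  Polynomial.coeff_eq_zero_of_natDegree_lt (lt_of_le_of_lt (PA_natDegree a) hn)

def QP {d : ℕ} (k : ℂ) (a b : Fin (d + 1) → ℂ) : Polynomial ℂ :=
  Polynomial.C k * PA a - PA b * Polynomial.X ^ d

lemma QP_natDegree {d : ℕ} (k : ℂ) (a b : Fin (d + 1) → ℂ) : (QP k a b).natDegree ≤ 2 * d := by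
  refine (Polynomial.natDegree_sub_le _ _).trans (max_le ?_ ?_)
  · refine (Polynomial.natDegree_C_mul_le _ _).trans ?_
    have := PA_natDegree a
    omega
  · refine Polynomial.natDegree_mul_le.trans ?_
    rw [Polynomial.natDegree_X_pow]
    have := PA_natDegree b
    omega

lemma QP_coeff_lt {d : ℕ} (k : ℂ) (a b : Fin (d + 1) → ℂ) (n : Fin (d + 1)) (hn : (n : ℕ) < d) :
    (QP k a b).coeff n = k * a n := by
  rw [QP, Polynomial.coeff_sub, Polynomial.coeff_C_mul, PA_coeff_lt, Polynomial.coeff_mul_X_pow',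
    if_neg (by omega), sub_zero]

lemma QP_coeff_d {d : ℕ} (k : ℂ) (a b : Fin (d + 1) → ℂ) :
    (QP k a b).coeff d = k * a (Fin.last d) - b 0 := by
  have h1 := PA_coeff_lt a (Fin.last d)
  have h2 := PA_coeff_lt b 0
  rw [Fin.val_last] at h1
  rw [Fin.val_zero] at h2
  rw [QP, Polynomial.coeff_sub, Polynomial.coeff_C_mul, h1, Polynomial.coeff_mul_X_pow',
    if_pos le_rfl, Nat.sub_self, h2]

lemma QP_coeff_gt {d : ℕ} (k : ℂ) (a b : Fin (d + 1) → ℂ) (n : Fin (d + 1)) (hn : 0 < (n : ℕ)) :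
    (QP k a b).coeff (d + n) = - b n := by
  rw [QP, Polynomial.coeff_sub, Polynomial.coeff_C_mul, PA_coeff_gt _ _ (by omega),
    Polynomial.coeff_mul_X_pow', if_pos (by omega), Nat.add_sub_cancel_left, PA_coeff_lt]
  simp

lemma QP_zero {d : ℕ} (k : ℂ) (hk : k ≠ 0) (a b : Fin (d + 1) → ℂ) (h : QP k a b = 0)
    (hb : b 0 = 0) : (∀ j, a j = 0) ∧ (∀ j, b j = 0) := by
  constructor
  · intro j
    by_cases hj : (j : ℕ) < d
    · have := QP_coeff_lt k a b j hj
      rw [h, Polynomial.coeff_zero] at this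
      simpa [hk] using this.symm
    · have hj' : j = Fin.last d := Fin.ext (by rw [Fin.val_last]; omega)
      have := QP_coeff_d k a b
      rw [h, Polynomial.coeff_zero, hb, sub_zero] at this
      rw [hj']
      simpa [hk] using this.symm
  · intro j
    by_cases hj : 0 < (j : ℕ)
    · have := QP_coeff_gt k a b j hj
      rw [h, Polynomial.coeff_zero] at this
      simpa using this.symm
    · have hj' : j = 0 := Fin.ext (by rw [Fin.val_zero]; omega)
      rw [hj', hb]

abbrev EV (d : ℕ) : Type := Fin 2 × Fin 2 × Fin (d + 1) → ℂ

def half (d : ℕ) (k : Fin 2) : EV d →L[ℂ] CV d :=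
  ContinuousLinearMap.pi fun x => ContinuousLinearMap.proj (k, x)

@[simp] lemma half_apply (d : ℕ) (k : Fin 2) (p : EV d) (x) : half d k p x = p (k, x) := rfl

def DEq (d : ℕ) (c : Circle) (D : CV d →L[ℂ] C(Circle, ℂ)) : Prop :=
  ∀ δ (z : Circle), D δ (c * z ^ d) - c * d * (z : ℂ) ^ (d - 1) * D δ z =
        (∑ j : Fin (d + 1), δ (0, j) * (z : ℂ) ^ (j : ℕ)) -
        (∑ j : Fin (d + 1), δ (1, j) * (z : ℂ) ^ (j : ℕ)) * (c * (z : ℂ) ^ d)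

lemma DEq_QP (d : ℕ) (hd : 2 ≤ d) (c : Circle) (D : CV d →L[ℂ] C(Circle, ℂ)) (hD : DEq d c D)
    (δ : CV d) (z : Circle) :
    (z : ℂ) ^ d * (D δ (c * z ^ d) / ((c * z ^ d : Circle) : ℂ) - d * (D δ z / z)) =
      (QP (c : ℂ)⁻¹ (fun j => δ (0, j)) (fun j => δ (1, j))).eval (z : ℂ) := by
  have hc0 : (c : ℂ) ≠ 0 := Circle.coe_ne_zero c
  have hz0 : (z : ℂ) ≠ 0 := Circle.coe_ne_zero z
  have h := hD δ z
  simp only [QP, Polynomial.eval_sub, Polynomial.eval_mul, Polynomial.eval_C, Polynomial.eval_pow,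
    Polynomial.eval_X, PA_eval]
  rw [Circle.coe_mul, Circle.coe_pow]
  obtain ⟨e, rfl⟩ : ∃ e, d = e + 1 := ⟨d - 1, by omega⟩
  rw [Nat.add_sub_cancel] at h
  generalize (∑ j : Fin (e + 1 + 1), δ (0, j) * (z : ℂ) ^ (j : ℕ)) = S1 at *
  generalize (∑ j : Fin (e + 1 + 1), δ (1, j) * (z : ℂ) ^ (j : ℕ)) = S2 at *
  have hze : (z : ℂ) ^ e ≠ 0 := pow_ne_zero _ hz0
  generalize D δ (c * z ^ (e + 1)) = W at *
  rw [pow_succ] at *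
  field_simp
  linear_combination h

lemma ker_five (d : ℕ) (hd : 2 ≤ d) (c : Circle) (hc : orderOf c = d + 1)
    (D1 D2 : CV d →L[ℂ] C(Circle, ℂ)) (h1 : DEq d 1 D1) (h2 : DEq d c D2) (δ : EV d)
    (heq : ∀ z : Circle, IsOfFinOrder z → D1 (half d 0 δ) z = D2 (half d 1 δ) z)
    (e1 : δ (0, 1, 0) = 0) (e2 : δ (1, 1, 0) = 0) (e3 : δ (1, 1, ⟨1, by omega⟩) = 0)
    (e4 : δ (1, 0, ⟨d - 1, by omega⟩) = 0) (e5 : δ (1, 0, Fin.last d) = 0) : δ = 0 := by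
  have hcf : IsOfFinOrder c := by rw [← orderOf_pos_iff, hc]; omega
  have hc0 : (c : ℂ)⁻¹ ≠ 0 := inv_ne_zero (Circle.coe_ne_zero c)
  obtain ⟨hF, hG⟩ := ker_poly d hd c hc (fun z => D1 (half d 0 δ) z / z)
    (QP 1 (fun j => δ (0, 0, j)) (fun j => δ (0, 1, j)))
    (QP (c : ℂ)⁻¹ (fun j => δ (1, 0, j)) (fun j => δ (1, 1, j)))
    (QP_natDegree _ _ _) (QP_natDegree _ _ _)
    (by
      intro z hz
      have := DEq_QP d hd 1 D1 h1 (half d 0 δ) z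
      rw [one_mul, Circle.coe_one, inv_one] at this
      exact this)
    (by
      intro z hz
      have := DEq_QP d hd c D2 h2 (half d 1 δ) z
      rw [← heq z hz, ← heq _ (hcf.mul hz.pow)] at this
      exact this)
    (by
      have := QP_coeff_lt (c : ℂ)⁻¹ (fun j => δ (1, 0, j)) (fun j => δ (1, 1, j)) ⟨d - 1, by omega⟩
        (by show d - 1 < d; omega)
      rw [e4, mul_zero] at this
      exact this)
    (by rw [QP_coeff_d, e5, e2]; simp)
    (by
      have := QP_coeff_gt (c : ℂ)⁻¹ (fun j => δ (1, 0, j)) (fun j => δ (1, 1, j)) ⟨1, by omega⟩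
        (by show 0 < 1; omega)
      rw [e3, neg_zero] at this
      exact this)
  obtain ⟨f1, f2⟩ := QP_zero _ one_ne_zero _ _ hF e1
  obtain ⟨f3, f4⟩ := QP_zero _ hc0 _ _ hG e2
  funext ⟨k, l, j⟩
  fin_cases k <;> fin_cases l
  · exact f1 j
  · exact f2 j
  · exact f3 j
  · exact f4 j

lemma surj_of_li {V : Type*} [AddCommGroup V] [Module ℂ V] {n : ℕ} (f : Fin n → Module.Dual ℂ V)
    (hli : LinearIndependent ℂ f) : Function.Surjective (fun (v : V) (i : Fin n) => f i v) := by
  let Λ : V →ₗ[ℂ] (Fin n → ℂ) := LinearMap.pi f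
  have : Function.Surjective Λ := by
    rw [← LinearMap.range_eq_top]
    by_contra hne
    obtain ⟨φ, hφ0, hφ⟩ := Submodule.exists_le_ker_of_lt_top _ (lt_top_iff_ne_top.mpr hne)
    apply hφ0
    have key : ∀ x, φ x = ∑ i, x i * φ (fun j => if i = j then 1 else 0) := fun x => by
      rw [LinearMap.pi_apply_eq_sum_univ φ x]; rfl
    have hz : ∑ i, φ (fun j => if i = j then 1 else 0) • f i = 0 := by
      refine LinearMap.ext fun δ => ?_
      have h3 : φ (Λ δ) = 0 := hφ ⟨δ, rfl⟩
      rw [LinearMap.zero_apply]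
      refine Eq.trans ?_ h3
      rw [key, LinearMap.sum_apply]
      refine Finset.sum_congr rfl fun i _ => ?_
      rw [LinearMap.smul_apply, smul_eq_mul, mul_comm]; rfl
    have := Fintype.linearIndependent_iff.mp hli _ hz
    refine LinearMap.ext fun x => ?_
    rw [key]
    exact Finset.sum_eq_zero fun i _ => by rw [this i, mul_zero]
  exact this

lemma exists_points (d : ℕ) (hd : 2 ≤ d) (c : Circle) (hc : orderOf c = d + 1)
    (D1 D2 : CV d →L[ℂ] C(Circle, ℂ)) (h1 : DEq d 1 D1) (h2 : DEq d c D2) :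
    ∃ ζ : Fin (4 * d - 1) → Circle, (∀ i, IsOfFinOrder (ζ i)) ∧ Function.Injective ζ ∧
      Function.Surjective (fun (δ : EV d) (i : Fin (4 * d - 1)) =>
        D1 (half d 0 δ) (ζ i) - D2 (half d 1 δ) (ζ i)) := by
  let ev : Circle → Module.Dual ℂ (EV d) := fun z =>
    { toFun := fun δ => D1 (half d 0 δ) z - D2 (half d 1 δ) z
      map_add' := by intro x y; simp; ring
      map_smul' := by intro x y; simp; ring }
  let S : Set (Module.Dual ℂ (EV d)) := ev '' {z | IsOfFinOrder z}
  let W := Submodule.span ℂ S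
  have hker : Module.finrank ℂ W.dualCoannihilator ≤ 5 := by
    let five : W.dualCoannihilator →ₗ[ℂ] (Fin 5 → ℂ) :=
      (LinearMap.pi (fun i : Fin 5 => LinearMap.proj
        ((![(0, 1, 0), (1, 1, 0), (1, 1, ⟨1, by omega⟩), (1, 0, ⟨d - 1, by omega⟩),
          (1, 0, Fin.last d)] : Fin 5 → Fin 2 × Fin 2 × Fin (d + 1)) i))) ∘ₗ
        W.dualCoannihilator.subtype
    have hinj : Function.Injective five := by
      rw [injective_iff_map_eq_zero]
      rintro ⟨δ, hδ⟩ h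
      have hh := fun i => congrFun h i
      have g := ker_five d hd c hc D1 D2 h1 h2 δ ?_ (hh 0) (hh 1) (hh 2) (hh 3) (hh 4)
      · exact Subtype.ext g
      · intro z hz
        rw [Submodule.mem_dualCoannihilator] at hδ
        have := hδ (ev z) (Submodule.subset_span ⟨z, hz, rfl⟩)
        exact sub_eq_zero.mp this
    simpa using LinearMap.finrank_le_finrank_of_injective hinj
  have hsum := Subspace.finrank_add_finrank_dualCoannihilator_eq W
  have hdim : Module.finrank ℂ (EV d) = 4 * d + 4 := by
    simp; ring
  have hW : 4 * d - 1 ≤ Module.finrank ℂ W := by omega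
  obtain ⟨f, hfS, -, hfl⟩ := Submodule.exists_fun_fin_finrank_span_eq ℂ S
  choose ζ' hζ' using hfS
  let ζ : Fin (4 * d - 1) → Circle := fun i => ζ' (Fin.castLE hW i)
  have hli : LinearIndependent ℂ (fun i => ev (ζ i)) := by
    have : (fun i => ev (ζ i)) = f ∘ Fin.castLE hW := by
      funext i; exact (hζ' _).2
    rw [this]
    exact hfl.comp _ (Fin.castLE_injective hW)
  refine ⟨ζ, fun i => (hζ' _).1, ?_, ?_⟩
  · intro i j hij
    exact hli.injective (congrArg ev hij)
  · exact surj_of_li _ hli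

lemma solve_near {E : Type*} [NormedAddCommGroup E] [NormedSpace ℂ E] [FiniteDimensional ℂ E]
    {n : ℕ} (H1 H2 : E → C(Circle, ℂ)) (D1 D2 : E →L[ℂ] C(Circle, ℂ)) (p0 : E)
    (h1 : HasStrictFDerivAt H1 D1 p0) (h2 : HasStrictFDerivAt H2 D2 p0)
    (i1 : H1 p0 = idC) (i2 : H2 p0 = idC) (ζ : Fin n → Circle)
    (hsurj : Function.Surjective (fun (δ : E) (i : Fin n) => D1 δ (ζ i) - D2 δ (ζ i)))
    (q : E) (t : Fin n → ℤ)
    (hq : ∀ i, D1 q (ζ i) - D2 q (ζ i) = (ζ i : ℂ) * (2 * Real.pi * t i * Complex.I))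
    (η : ℝ) (hη : 0 < η) :
    ∀ᶠ m : ℕ in Filter.atTop, ∃ p : E, ‖p - (p0 + (m : ℂ)⁻¹ • q)‖ ≤ η * (m : ℝ)⁻¹ ∧
      ∀ i, H1 p (ζ i) = H2 p (ζ i * Circle.exp (2 * Real.pi * t i / m)) := by
  have : CompleteSpace E := FiniteDimensional.complete ℂ E
  let Lx : (Fin n → Circle) → E →L[ℂ] (Fin n → ℂ) := fun ξ =>
    ContinuousLinearMap.pi fun i => (ContinuousMap.evalCLM ℂ (ζ i)).comp D1
      - (ContinuousMap.evalCLM ℂ (ξ i)).comp D2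
  have Lx_apply : ∀ ξ v i, Lx ξ v i = D1 v (ζ i) - D2 v (ξ i) := fun _ _ _ => rfl
  have hLc : Continuous Lx := by
    rw [continuous_clm_apply]
    intro v
    refine continuous_pi fun i => ?_
    simp only [Lx_apply]
    fun_prop
  set A := Lx ζ with hA
  have hAs : Function.Surjective A := hsurj
  let N := A.nonlinearRightInverseOfSurjective (LinearMap.range_eq_top.mpr hAs)
  have hNpos : 0 < N.nnnorm := ContinuousLinearMap.nonlinearRightInverseOfSurjective_nnnorm_pos _ _
  set κ : ℝ := (N.nnnorm : ℝ)⁻¹ with hκ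
  have hκpos : 0 < κ := inv_pos.mpr (by exact_mod_cast hNpos)
  have hden : 0 < 2 * (3 * ‖q‖ + 1 + 3 * η) := by positivity
  set ε : ℝ := κ * η / (2 * (3 * ‖q‖ + 1 + 3 * η)) with hε
  have hεpos : 0 < ε := by positivity
  have hεeq : ε * (2 * (3 * ‖q‖ + 1 + 3 * η)) = κ * η := by rw [hε]; field_simp
  have hb : 3 * ε * ‖q‖ + ε ≤ (κ - 3 * ε) * η := by
    have := norm_nonneg q
    have h3 : 0 ≤ ε * ‖q‖ := by positivity
    have h4 : 0 ≤ ε * η := by positivity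
    nlinarith
  obtain ⟨s1, hs1, a1⟩ := h1.approximates_deriv_on_nhds (c := ⟨ε, hεpos.le⟩) (Or.inr hεpos)
  obtain ⟨s2, hs2, a2⟩ := h2.approximates_deriv_on_nhds (c := ⟨ε, hεpos.le⟩) (Or.inr hεpos)
  obtain ⟨r, hr, hrs⟩ := Metric.mem_nhds_iff.mp (Filter.inter_mem hs1 hs2)
  let ξ : ℕ → Fin n → Circle := fun m i => ζ i * Circle.exp (2 * Real.pi * t i / m)
  have hinv0 : Filter.Tendsto (fun m : ℕ => (m : ℝ)⁻¹) Filter.atTop (𝓝 0) :=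
    tendsto_inv_atTop_nhds_zero_nat
  have hξ : Filter.Tendsto ξ Filter.atTop (𝓝 ζ) := by
    rw [tendsto_pi_nhds]
    intro i
    have h3 : Filter.Tendsto (fun m : ℕ => 2 * Real.pi * t i / (m : ℝ)) Filter.atTop (𝓝 0) := by
      simpa [div_eq_mul_inv] using hinv0.const_mul (2 * Real.pi * t i)
    have h4 := ((Circle.exp.continuous.tendsto 0).comp h3).const_mul (ζ i)
    simpa using h4
  have e1 : ∀ᶠ m in Filter.atTop, ‖Lx (ξ m) - A‖ ≤ ε := by
    have := ((hLc.tendsto ζ).comp hξ).sub_const A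
    rw [← hA, sub_self] at this
    have := this.norm
    rw [norm_zero] at this
    exact (this.eventually (gt_mem_nhds hεpos)).mono fun m hm => le_of_lt hm
  have e2 : ∀ᶠ m : ℕ in Filter.atTop, (‖q‖ + η) * (m : ℝ)⁻¹ < r := by
    have := hinv0.const_mul (‖q‖ + η)
    rw [mul_zero] at this
    exact this.eventually (gt_mem_nhds hr)
  have e3 : ∀ᶠ m : ℕ in Filter.atTop, ∀ i, ‖(2 * Real.pi * t i * Complex.I : ℂ)‖ * (m : ℝ)⁻¹ ≤ 1 ∧
      ‖(2 * Real.pi * t i * Complex.I : ℂ)‖ ^ 2 * (m : ℝ)⁻¹ ≤ ε := by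
    rw [Filter.eventually_all]
    intro i
    have h3 := hinv0.const_mul ‖(2 * Real.pi * t i * Complex.I : ℂ)‖
    have h4 := hinv0.const_mul (‖(2 * Real.pi * t i * Complex.I : ℂ)‖ ^ 2)
    rw [mul_zero] at h3 h4
    filter_upwards [h3.eventually (gt_mem_nhds one_pos), h4.eventually (gt_mem_nhds hεpos)]
      with m x y using ⟨x.le, y.le⟩
  filter_upwards [e1, e2, e3, Filter.eventually_gt_atTop 0] with m f1 f2 f3 hm
  have hm0 : (0 : ℝ) < (m : ℝ)⁻¹ := by positivity
  let F : E → Fin n → ℂ := fun p i => H1 p (ζ i) - H2 p (ξ m i)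
  have hFa : ApproximatesLinearOn F A (Metric.ball p0 r) ⟨3 * ε, by positivity⟩ := by
    intro x hx y hy
    have b1 := a1 x (hrs hx).1 y (hrs hy).1
    have b2 := a2 x (hrs hx).2 y (hrs hy).2
    have b3 := (Lx (ξ m) - A).le_of_opNorm_le f1 (x - y)
    change _ ≤ 3 * ε * ‖x - y‖
    rw [pi_norm_le_iff_of_nonneg (by positivity)]
    intro i
    have c1 := ((H1 x - H1 y - D1 (x - y)).norm_coe_le_norm (ζ i)).trans b1
    have c2 := ((H2 x - H2 y - D2 (x - y)).norm_coe_le_norm (ξ m i)).trans b2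
    have c3 := (norm_le_pi_norm ((Lx (ξ m) - A) (x - y)) i).trans b3
    have id : (F x - F y - A (x - y)) i = (H1 x - H1 y - D1 (x - y)) (ζ i)
        - (H2 x - H2 y - D2 (x - y)) (ξ m i) + ((Lx (ξ m) - A) (x - y)) i := by
      simp only [Pi.sub_apply, ContinuousMap.sub_apply, sub_apply, hA, Lx_apply, F]
      ring
    rw [id]
    change _ ≤ ε * ‖x - y‖ at c1
    change _ ≤ ε * ‖x - y‖ at c2
    have := norm_add_le ((H1 x - H1 y - D1 (x - y)) (ζ i)
        - (H2 x - H2 y - D2 (x - y)) (ξ m i)) (((Lx (ξ m) - A) (x - y)) i)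
    have := norm_sub_le ((H1 x - H1 y - D1 (x - y)) (ζ i)) ((H2 x - H2 y - D2 (x - y)) (ξ m i))
    linarith
  have hnm : ‖(m : ℂ)⁻¹ • q‖ = ‖q‖ * (m : ℝ)⁻¹ := by
    rw [norm_smul, norm_inv, Complex.norm_natCast, mul_comm]
  set b := p0 + (m : ℂ)⁻¹ • q with hbdef
  have hball : Metric.closedBall b (η * (m : ℝ)⁻¹) ⊆ Metric.ball p0 r := by
    intro x hx
    rw [Metric.mem_closedBall, dist_eq_norm] at hx
    rw [Metric.mem_ball, dist_eq_norm]
    have : x - p0 = (x - b) + (m : ℂ)⁻¹ • q := by rw [hbdef]; abel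
    rw [this]
    have := norm_add_le (x - b) ((m : ℂ)⁻¹ • q)
    rw [hnm] at this
    nlinarith
  have hsur := hFa.surjOn_closedBall_of_nonlinearRightInverse N (b := b) (ε := η * (m : ℝ)⁻¹)
    (by positivity) hball
  have h0mem : (0 : Fin n → ℂ) ∈ Metric.closedBall (F b) ((κ - 3 * ε) * (η * (m : ℝ)⁻¹)) := by
    rw [Metric.mem_closedBall, dist_comm, dist_zero_right]
    have hbm : b ∈ Metric.ball p0 r := hball (Metric.mem_closedBall_self (by positivity))
    have g1 := hFa b hbm p0 (Metric.mem_ball_self hr)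
    have hbp : b - p0 = (m : ℂ)⁻¹ • q := by rw [hbdef]; abel
    rw [hbp, hnm] at g1
    change _ ≤ 3 * ε * (‖q‖ * (m : ℝ)⁻¹) at g1
    have g2 : ‖F p0 + A ((m : ℂ)⁻¹ • q)‖ ≤ ε * (m : ℝ)⁻¹ := by
      rw [pi_norm_le_iff_of_nonneg (by positivity)]
      intro i
      set w : ℂ := 2 * Real.pi * t i * Complex.I with hw
      have k1 : (F p0 + A ((m : ℂ)⁻¹ • q)) i = -((ζ i : ℂ) * (Complex.exp (w * (m : ℂ)⁻¹) - 1 - w * (m : ℂ)⁻¹)) := by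
        rw [map_smul]
        simp only [Pi.add_apply, Pi.smul_apply, hA, Lx_apply, F, i1, i2, idC_apply, ξ, hq i, smul_eq_mul]
        rw [Circle.coe_mul, Circle.coe_exp]
        have : ((2 * Real.pi * t i / m : ℝ) : ℂ) * Complex.I = w * (m : ℂ)⁻¹ := by
          rw [hw]; push_cast; ring
        rw [this]
        ring
      rw [k1, norm_neg, norm_mul, Circle.norm_coe, one_mul]
      have hwn : ‖w * (m : ℂ)⁻¹‖ = ‖w‖ * (m : ℝ)⁻¹ := by
        rw [norm_mul, norm_inv, Complex.norm_natCast]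
      refine (Complex.norm_exp_sub_one_sub_id_le (by rw [hwn]; exact (f3 i).1)).trans ?_
      rw [hwn, mul_pow, pow_two (m : ℝ)⁻¹, ← mul_assoc]
      exact mul_le_mul_of_nonneg_right (f3 i).2 hm0.le
    have : F b = (F b - F p0 - A ((m : ℂ)⁻¹ • q)) + (F p0 + A ((m : ℂ)⁻¹ • q)) := by abel
    rw [this]
    refine (norm_add_le _ _).trans ((add_le_add g1 g2).trans ?_)
    nlinarith
  obtain ⟨p, hp, hp0⟩ := hsur h0mem
  refine ⟨p, by rwa [Metric.mem_closedBall, dist_eq_norm] at hp, fun i => ?_⟩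
  exact sub_eq_zero.mp (congrFun hp0 i)

lemma eval_smul_homog {σ : Type*} [Fintype σ] {φ : MvPolynomial σ ℂ} {n : ℕ}
    (h : φ.IsHomogeneous n) (s : ℂ) (x : σ → ℂ) : eval (s • x) φ = s ^ n * eval x φ := by
  rw [eval_eq', eval_eq', Finset.mul_sum]
  refine Finset.sum_congr rfl fun mo hmo => ?_
  have h1 : ∑ i, mo i = n := by
    have := h (mem_support_iff.mp hmo)
    rw [Finsupp.weight_apply, Finsupp.sum_fintype _ _ (by simp)] at this
    simpa using this
  simp only [Pi.smul_apply, smul_eq_mul, mul_pow, Finset.prod_mul_distrib]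
  rw [Finset.prod_pow_eq_pow_sum, h1]
  ring

lemma poly_expand {σ : Type*} [Fintype σ] (Ψ : MvPolynomial σ ℂ) (hΨ : Ψ ≠ 0) :
    ∃ (k : ℕ) (χ : MvPolynomial σ ℂ) (G : ℂ × (σ → ℂ) → ℂ), χ ≠ 0 ∧ Continuous G ∧
      (∀ x, G (0, x) = eval x χ) ∧ ∀ s x, eval (s • x) Ψ = s ^ k * G (s, x) := by
  classical
  have hex : ∃ k, homogeneousComponent k Ψ ≠ 0 := by
    by_contra hne
    push Not at hne
    exact hΨ (by rw [← sum_homogeneousComponent Ψ]; exact Finset.sum_eq_zero fun i _ => hne i)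
  have hk := Nat.find_spec hex
  have hmin : ∀ i < Nat.find hex, homogeneousComponent i Ψ = 0 := fun i hi =>
    not_not.mp (Nat.find_min hex hi)
  set k := Nat.find hex with hkdef
  have hkr : k ∈ Finset.range (Ψ.totalDegree + 1) := by
    rw [Finset.mem_range]
    by_contra hlt
    exact hk (homogeneousComponent_eq_zero _ _ (by omega))
  refine ⟨k, homogeneousComponent k Ψ, fun y => ∑ i ∈ Finset.range (Ψ.totalDegree + 1),
    y.1 ^ (i - k) * eval y.2 (homogeneousComponent i Ψ), hk, ?_, ?_, ?_⟩
  · refine continuous_finsetSum _ fun i _ => ?_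
    exact (continuous_fst.pow _).mul ((MvPolynomial.continuous_eval _).comp continuous_snd)
  · intro x
    change ∑ i ∈ Finset.range (Ψ.totalDegree + 1), (0 : ℂ) ^ (i - k) * eval x (homogeneousComponent i Ψ) = _
    rw [Finset.sum_eq_single k _ (fun h => (h hkr).elim)]
    · simp
    · intro i _ hik
      rcases lt_or_gt_of_ne hik with h | h
      · simp [hmin i h]
      · simp [Nat.sub_ne_zero_of_lt h]
  · intro s x
    conv_lhs => rw [← sum_homogeneousComponent Ψ]
    rw [map_sum, Finset.mul_sum]
    refine Finset.sum_congr rfl fun i _ => ?_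
    rw [eval_smul_homog (homogeneousComponent_isHomogeneous i Ψ)]
    by_cases hi : i < k
    · simp [hmin i hi]
    · rw [← mul_assoc, ← pow_add, Nat.add_sub_cancel' (not_lt.mp hi)]

lemma poly_choose {σ : Type*} [Fintype σ] [DecidableEq σ] (Φ : MvPolynomial σ ℂ) (hΦ : Φ ≠ 0)
    (p0 : σ → ℂ) {n : ℕ} (A : (σ → ℂ) →ₗ[ℂ] (Fin n → ℂ)) (hA : Function.Surjective A)
    (w : Fin n → ℂ) (hw : ∀ i, w i ≠ 0) :
    ∃ (q : σ → ℂ) (t : Fin n → ℤ), (∀ i, A q i = w i * t i) ∧ ∃ η > 0,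
      ∀ᶠ m : ℕ in Filter.atTop, ∀ p : σ → ℂ, ‖p - (p0 + (m : ℂ)⁻¹ • q)‖ ≤ η * (m : ℝ)⁻¹ →
        eval p Φ ≠ 0 := by
  let Ψ : MvPolynomial σ ℂ := bind₁ (fun i => X i + C (p0 i)) Φ
  have hev : ∀ x, eval x Ψ = eval (x + p0) Φ := by
    intro x
    simp only [Ψ, eval, eval₂Hom_bind₁]
    congr 2
    funext i
    simp
  have hΨ : Ψ ≠ 0 := by
    intro h0
    apply hΦ
    apply MvPolynomial.funext
    intro x
    have := hev (x - p0)
    rw [h0, sub_add_cancel] at this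
    rw [← this, map_zero, map_zero]
  obtain ⟨k, χ, G, hχ, hGc, hG0, hG⟩ := poly_expand Ψ hΨ
  obtain ⟨q', hq'⟩ : ∃ q', eval q' χ ≠ 0 := by
    by_contra hne
    push Not at hne
    exact hχ (MvPolynomial.funext fun x => by rw [hne, map_zero])
  obtain ⟨R, hR⟩ := A.exists_rightInverse_of_surjective (LinearMap.range_eq_top.mpr hA)
  let Q : (Fin n → ℂ) → σ → ℂ := fun y => q' - R (A q') + R (fun i => w i * y i)
  have hAQ : ∀ y i, A (Q y) i = w i * y i := by
    intro y i
    have h1 : ∀ v, A (R v) = v := fun v => LinearMap.congr_fun hR v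
    simp only [Q, map_add, map_sub, h1, sub_self, zero_add]
  let Ω : MvPolynomial (Fin n) ℂ := bind₁ (fun j =>
    C ((q' - R (A q')) j) + ∑ i, C (R (Pi.single i 1) j * w i) * X i) χ
  have hΩ : ∀ y, eval y Ω = eval (Q y) χ := by
    intro y
    simp only [Ω, eval, eval₂Hom_bind₁]
    congr 2
    funext j
    have h2 : R (fun i => w i * y i) = ∑ i, (w i * y i) • R (Pi.single i 1) := by
      conv_lhs => rw [pi_eq_sum_univ' (fun i => w i * y i)]
      simp only [map_sum, map_smul]
    simp only [Q, Pi.add_apply, h2, Finset.sum_apply, Pi.smul_apply, smul_eq_mul]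
    simp only [map_add, map_sum, map_mul, coe_eval₂Hom, eval₂_C, eval₂_X, RingHom.id_apply]
    congr 1
    exact Finset.sum_congr rfl fun i _ => by ring
  have hΩ0 : Ω ≠ 0 := by
    intro h0
    have := hΩ (fun i => (w i)⁻¹ * A q' i)
    rw [h0, map_zero] at this
    apply hq'
    rw [this]
    congr 1
    simp [Q, hw]
  obtain ⟨t, ht⟩ : ∃ t : Fin n → ℤ, eval (fun i => (t i : ℂ)) Ω ≠ 0 := by
    by_contra hne
    push Not at hne
    apply hΩ0
    refine MvPolynomial.funext_set (fun _ => Set.range (Int.cast : ℤ → ℂ))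
      (fun _ => Set.infinite_range_of_injective Int.cast_injective) ?_
    intro x hx
    choose t ht using fun i => hx i (Set.mem_univ i)
    have : x = fun i => (t i : ℂ) := funext fun i => (ht i).symm
    rw [this, hne, map_zero]
  rw [hΩ] at ht
  set q := Q (fun i => (t i : ℂ)) with hq
  refine ⟨q, t, fun i => hAQ _ i, ?_⟩
  have hopen : ∀ᶠ y in 𝓝 ((0 : ℂ), q), G y ≠ 0 :=
    hGc.continuousAt.eventually_ne (by rw [hG0]; exact ht)
  obtain ⟨r, hr, hball⟩ := Metric.eventually_nhds_iff.mp hopen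
  refine ⟨r / 2, by positivity, ?_⟩
  have hinv : ∀ᶠ m : ℕ in Filter.atTop, (m : ℝ)⁻¹ < r :=
    tendsto_inv_atTop_nhds_zero_nat.eventually (gt_mem_nhds hr)
  filter_upwards [hinv, Filter.eventually_gt_atTop 0] with m h1 h2 p hp
  have hm0 : (m : ℂ) ≠ 0 := by exact_mod_cast h2.ne'
  have hmp : (0 : ℝ) < m := by exact_mod_cast h2
  set x : σ → ℂ := (m : ℂ) • (p - p0) with hx
  have hpx : p = (m : ℂ)⁻¹ • x + p0 := by
    rw [hx, smul_smul, inv_mul_cancel₀ hm0, one_smul, sub_add_cancel]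
  rw [hpx, ← hev, hG]
  refine mul_ne_zero (pow_ne_zero _ (inv_ne_zero hm0)) (hball ?_)
  rw [Prod.dist_eq, max_lt_iff]
  constructor
  · rw [dist_zero_right, norm_inv, Complex.norm_natCast]; exact h1
  · rw [dist_eq_norm]
    clear_value q
    have h3 : x - q = (m : ℂ) • (p - (p0 + (m : ℂ)⁻¹ • q)) := by
      rw [hx, ← sub_sub, smul_sub _ (p - p0), smul_smul, mul_inv_cancel₀ hm0, one_smul]
    rw [h3, norm_smul, Complex.norm_natCast]
    calc (m : ℝ) * ‖p - (p0 + (m : ℂ)⁻¹ • q)‖ ≤ m * (r / 2 * (m : ℝ)⁻¹) := by gcongr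
      _ = r / 2 := by field_simp
      _ < r := by linarith

lemma homEval_sub_le {d : ℕ} (a a' : Fin (d + 1) → ℂ) (v : Fin 2 → ℂ) (ε : ℝ)
    (h : ∀ j, ‖a j - a' j‖ ≤ ε) :
    ‖homEval a v - homEval a' v‖ ≤ (d + 1) * ε * ‖v‖ ^ d := by
  unfold homEval
  rw [← Finset.sum_sub_distrib]
  refine (norm_sum_le_of_le _ (n := fun _ => ε * ‖v‖ ^ d) fun j _ => ?_).trans ?_
  · have h0 : 0 ≤ ε := (norm_nonneg _).trans (h j)
    have hj : (j : ℕ) ≤ d := Nat.lt_succ_iff.mp j.2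
    rw [← sub_mul, ← sub_mul, norm_mul, norm_mul, norm_pow, norm_pow, mul_assoc]
    have : ‖v‖ ^ d = ‖v‖ ^ (j : ℕ) * ‖v‖ ^ (d - (j : ℕ)) := by
      rw [← pow_add, Nat.add_sub_cancel' hj]
    rw [this]
    have n0 := norm_le_pi_norm v 0
    have n1 := norm_le_pi_norm v 1
    have := h j
    gcongr
  · simp [mul_assoc]

lemma homEval_q0_0 (d : ℕ) (c : Circle) (v : Fin 2 → ℂ) :
    homEval (fun j => q0 d c (0, j)) v = c * v 0 ^ d := by
  unfold homEval q0
  rw [Finset.sum_eq_single (Fin.last d)]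
  · simp
  · intro b _ hb; simp [hb]
  · simp

lemma homEval_q0_1 (d : ℕ) (c : Circle) (v : Fin 2 → ℂ) :
    homEval (fun j => q0 d c (1, j)) v = v 1 ^ d := by
  unfold homEval q0
  rw [Finset.sum_eq_single 0]
  · simp
  · intro b _ hb; simp [hb]
  · simp

lemma good_near (d : ℕ) (hd : 2 ≤ d) (c : Circle) :
    ∀ᶠ q in 𝓝 (q0 d c), GoodPair (fun j => q (0, j)) (fun j => q (1, j)) := by
  have hε : (0 : ℝ) < 1 / (2 * (d + 1)) := by positivity
  filter_upwards [Metric.ball_mem_nhds _ hε] with q hq v hv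
  rw [Metric.mem_ball, dist_eq_norm] at hq
  by_contra hcon
  push Not at hcon
  obtain ⟨ha, hb⟩ := hcon
  have hvpos : 0 < ‖v‖ := norm_pos_iff.mpr hv
  have hle : ∀ x, ‖q x - q0 d c x‖ ≤ 1 / (2 * (d + 1)) := fun x =>
    (norm_le_pi_norm (q - q0 d c) x).trans hq.le
  have e0 := homEval_sub_le _ _ v _ (fun j => hle (0, j))
  have e1 := homEval_sub_le _ _ v _ (fun j => hle (1, j))
  rw [ha, homEval_q0_0, zero_sub, norm_neg, norm_mul, Circle.norm_coe, one_mul, norm_pow] at e0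
  rw [hb, homEval_q0_1, zero_sub, norm_neg, norm_pow] at e1
  have hhalf : ((d : ℝ) + 1) * (1 / (2 * (d + 1))) = 1 / 2 := by
    field_simp
  rw [hhalf] at e0 e1
  have hlt : ∀ i, ‖v i‖ < ‖v‖ := by
    intro i
    have : ‖v i‖ ^ d < ‖v‖ ^ d := by
      have : 0 < ‖v‖ ^ d := by positivity
      fin_cases i
      · exact lt_of_le_of_lt e0 (by linarith)
      · exact lt_of_le_of_lt e1 (by linarith)
    exact lt_of_pow_lt_pow_left₀ d hvpos.le this
  exact lt_irrefl _ ((pi_norm_lt_iff hvpos).mpr hlt)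

lemma homEval_smul {d : ℕ} (a : Fin (d + 1) → ℂ) (s : ℂ) (v : Fin 2 → ℂ) :
    homEval a (s • v) = s ^ d * homEval a v := by
  unfold homEval
  rw [Finset.mul_sum]
  refine Finset.sum_congr rfl fun j _ => ?_
  have hj : (j : ℕ) ≤ d := Nat.lt_succ_iff.mp j.2
  have : s ^ d = s ^ (j : ℕ) * s ^ (d - (j : ℕ)) := by
    rw [← pow_add, Nat.add_sub_cancel' hj]
  rw [this]
  simp only [Pi.smul_apply, smul_eq_mul, mul_pow]
  ring

lemma toFun_toP1 {d : ℕ} (f : RatMap d) (x y : ℂ)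
    (h : ∑ j, f.a j * x ^ (j : ℕ) = (∑ j, f.b j * x ^ (j : ℕ)) * y) :
    f.toFun (toP1 x) = toP1 y := by
  have ev : ∀ a : Fin (d + 1) → ℂ, homEval a ![x, 1] = ∑ j, a j * x ^ (j : ℕ) := by
    intro a; simp [homEval]
  have hne : (![x, 1] : Fin 2 → ℂ) ≠ 0 := vec_ne (Or.inr one_ne_zero)
  have hb : homEval f.b ![x, 1] ≠ 0 := by
    rcases f.good _ hne with h1 | h1
    · rw [ev, h, ← ev] at h1
      exact left_ne_zero_of_mul h1
    · exact h1
  have ha : homEval f.a ![x, 1] = homEval f.b ![x, 1] * y := by rw [ev, ev, h]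
  obtain ⟨s, hs⟩ := Projectivization.exists_smul_eq_mk_rep ℂ (![x, 1] : Fin 2 → ℂ) hne
  have hs' : (toP1 x).rep = (s : ℂ) • ![x, 1] := hs.symm
  have hsd : ((s : ℂ)) ^ d ≠ 0 := pow_ne_zero _ s.ne_zero
  unfold RatMap.toFun ratFun
  have hcond : homEval f.a (toP1 x).rep ≠ 0 ∨ homEval f.b (toP1 x).rep ≠ 0 :=
    f.good _ (toP1 x).rep_nonzero
  rw [dif_pos hcond]
  unfold toP1
  rw [Projectivization.mk_eq_mk_iff']
  refine ⟨(s : ℂ) ^ d * homEval f.b ![x, 1], ?_⟩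
  have hs2 : (Projectivization.mk ℂ ![x, 1] (vec_ne (Or.inr one_ne_zero))).rep
    = (s : ℂ) • ![x, 1] := hs'
  rw [hs2, homEval_smul, homEval_smul, ha]
  funext i
  fin_cases i <;> simp [mul_assoc]

lemma preper_of_conj {d : ℕ} (f : RatMap d) (c : Circle) (hc : IsOfFinOrder c) (h : Circle → ℂ)
    (hf : ∀ z, f.toFun (toP1 (h z)) = toP1 (h (c * z ^ d))) (z : Circle) (hz : IsOfFinOrder z) :
    toP1 (h z) ∈ Preper f := by
  let T : Circle → Circle := fun z => c * z ^ d
  have hit : ∀ n, f.toFun^[n] (toP1 (h z)) = toP1 (h (T^[n] z)) := by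
    intro n
    induction n with
    | zero => rfl
    | succ n ih => rw [Function.iterate_succ_apply', ih, hf, Function.iterate_succ_apply']
  let S : Set Circle := Set.image2 (fun u v => u * v) (Submonoid.powers c) (Submonoid.powers z)
  have hS : S.Finite := Set.Finite.image2 _ hc.finite_powers hz.finite_powers
  have hmem : ∀ n, T^[n] z ∈ S := by
    intro n
    induction n with
    | zero => exact ⟨1, Submonoid.one_mem _, z, Submonoid.mem_powers z, one_mul z⟩
    | succ n ih =>
      obtain ⟨u, hu, v, hv, huv⟩ := ih
      refine ⟨c * u ^ d, Submonoid.mul_mem _ (Submonoid.mem_powers c) (Submonoid.pow_mem _ hu d),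
        v ^ d, Submonoid.pow_mem _ hv d, ?_⟩
      rw [Function.iterate_succ_apply', ← huv]
      change c * u ^ d * v ^ d = c * (u * v) ^ d
      rw [mul_pow, mul_assoc]
  obtain ⟨a, b, hab, he⟩ := Set.Finite.exists_lt_map_eq_of_forall_mem hmem hS
  exact ⟨b, a, hab, by rw [hit, hit, he]⟩

lemma toP1_injective : Function.Injective toP1 := by
  intro x y h
  unfold toP1 at h
  rw [Projectivization.mk_eq_mk_iff'] at h
  obtain ⟨s, hs⟩ := h
  have h0 := congrFun hs 0
  have h1 := congrFun hs 1
  simp at h0 h1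
  rw [← h0, h1, one_mul]

lemma exp_finOrder (t : ℤ) (m : ℕ) (hm : 0 < m) :
    IsOfFinOrder (Circle.exp (2 * Real.pi * t / m)) := by
  rw [isOfFinOrder_iff_pow_eq_one]
  refine ⟨m, hm, ?_⟩
  have hm' : (m : ℝ) ≠ 0 := by positivity
  rw [exp_pow, Circle.exp_eq_one]
  refine ⟨t, ?_⟩
  field_simp
/-- Pairs of degree-`d` rational maps sharing at least `4d - 1` preperiodic points are
Zariski dense in the space of all pairs: every bihomogeneous polynomial `Φ` that is
nonzero at the coefficient tuples of some pair of degree-`d` rational maps is also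
nonzero at the coefficient tuples of a pair sharing at least `4d - 1` preperiodic
points. -/
theorem statement3 (d : ℕ) (hd : 2 ≤ d)
    (Φ : MvPolynomial (Fin 2 × Fin 2 × Fin (d + 1)) ℂ) (hΦ : Bihomog Φ)
    (hnv : ∃ f g : RatMap d, eval (pairCoeffs f g) Φ ≠ 0) :
    ∃ f g : RatMap d, eval (pairCoeffs f g) Φ ≠ 0 ∧
      ∃ T : Finset P1, 4 * d - 1 ≤ T.card ∧ ↑T ⊆ Preper f ∩ Preper g := by
  classical
  have hΦ0 : Φ ≠ 0 := by
    rintro rfl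
    obtain ⟨f, g, h⟩ := hnv
    exact h (map_zero _)
  let c : Circle := Circle.exp (2 * Real.pi / ((d + 1 : ℕ) : ℝ))
  have hc : orderOf c = d + 1 := orderOf_exp (d + 1) (Nat.succ_pos d)
  have hcf : IsOfFinOrder c := orderOf_pos_iff.mp (by omega)
  obtain ⟨ψ1, D1, hd1, hi1, hf1, he1⟩ := conj_exists d hd 1
  obtain ⟨ψ2, D2, hd2, hi2, hf2, he2⟩ := conj_exists d hd c
  obtain ⟨ζ, hζf, hζi, hsurj⟩ := exists_points d hd c hc D1 D2 he1 he2
  let p0 : EV d := fun x => if x.1 = 0 then q0 d 1 x.2 else q0 d c x.2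
  have hp00 : half d 0 p0 = q0 d 1 := by
    funext x; simp [half_apply, p0]
  have hp01 : half d 1 p0 = q0 d c := by
    funext x; simp [half_apply, p0]
  let H1 : EV d → C(Circle, ℂ) := fun p => ψ1 (half d 0 p)
  let H2 : EV d → C(Circle, ℂ) := fun p => ψ2 (half d 1 p)
  have hH1 : HasStrictFDerivAt H1 (D1.comp (half d 0)) p0 :=
    HasStrictFDerivAt.comp p0 (by rw [hp00]; exact hd1) (half d 0).hasStrictFDerivAt
  have hH2 : HasStrictFDerivAt H2 (D2.comp (half d 1)) p0 :=
    HasStrictFDerivAt.comp p0 (by rw [hp01]; exact hd2) (half d 1).hasStrictFDerivAt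
  have hH10 : H1 p0 = idC := by simp only [H1, hp00, hi1]
  have hH20 : H2 p0 = idC := by simp only [H2, hp01, hi2]
  let A : EV d →ₗ[ℂ] (Fin (4 * d - 1) → ℂ) :=
    { toFun := fun δ i => D1 (half d 0 δ) (ζ i) - D2 (half d 1 δ) (ζ i)
      map_add' := by
        intro x y
        funext i
        simp only [map_add, ContinuousMap.add_apply, Pi.add_apply]
        ring
      map_smul' := by
        intro s x
        funext i
        simp only [map_smul, ContinuousMap.smul_apply, Pi.smul_apply, smul_eq_mul,
          RingHom.id_apply]
        ring }
  obtain ⟨q, t, hqt, η, hη, hev⟩ := poly_choose Φ hΦ0 p0 A hsurj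
    (fun i => (ζ i : ℂ) * (2 * Real.pi * Complex.I))
    (fun i => mul_ne_zero (Circle.coe_ne_zero _) Complex.two_pi_I_ne_zero)
  have hsol := solve_near H1 H2 (D1.comp (half d 0)) (D2.comp (half d 1)) p0 hH1 hH2 hH10 hH20 ζ
    hsurj q t (fun i => (hqt i).trans (by ring)) η hη
  -- neighbourhood conditions
  have t0 : Filter.Tendsto (half d 0) (𝓝 p0) (𝓝 (q0 d 1)) := by
    rw [← hp00]; exact (half d 0).continuous.tendsto p0
  have t1 : Filter.Tendsto (half d 1) (𝓝 p0) (𝓝 (q0 d c)) := by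
    rw [← hp01]; exact (half d 1).continuous.tendsto p0
  have hinj : ∀ᶠ p in 𝓝 p0, ∀ i j, i ≠ j → H1 p (ζ i) ≠ H1 p (ζ j) := by
    rw [Filter.eventually_all]
    intro i
    rw [Filter.eventually_all]
    intro j
    by_cases hij : i = j
    · exact Filter.Eventually.of_forall fun p h => (h hij).elim
    have cont : ∀ k, ContinuousAt (fun p => H1 p (ζ k)) p0 := fun k =>
      (ContinuousMap.evalCLM ℂ (ζ k)).continuous.continuousAt.comp hH1.continuousAt
    have hne : (fun p => H1 p (ζ i) - H1 p (ζ j)) p0 ≠ 0 := by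
      simp only [hH10, idC_apply]
      exact sub_ne_zero.mpr fun h => hij (hζi (Circle.ext h))
    exact (((cont i).sub (cont j)).eventually_ne hne).mono fun p hp _ h => hp (sub_eq_zero.mpr h)
  have hall := (((t0.eventually hf1).and (t1.eventually hf2)).and
    ((t0.eventually (good_near d hd 1)).and (t1.eventually (good_near d hd c)))).and hinj
  obtain ⟨r, hr, hball⟩ := Metric.eventually_nhds_iff.mp hall
  have hsmall : ∀ᶠ m : ℕ in Filter.atTop, (‖q‖ + η) * (m : ℝ)⁻¹ < r := by
    have := tendsto_inv_atTop_nhds_zero_nat (𝕜 := ℝ).const_mul (‖q‖ + η)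
    rw [mul_zero] at this
    exact this.eventually (gt_mem_nhds hr)
  obtain ⟨m, ⟨⟨p, hp1, hp2⟩, hpe⟩, hms, hm⟩ :=
    ((hsol.and hev).and (hsmall.and (Filter.eventually_gt_atTop 0))).exists
  have hpΦ := hpe p hp1
  have hpd : dist p p0 < r := by
    rw [dist_eq_norm]
    have e1 : p - p0 = (p - (p0 + (m : ℂ)⁻¹ • q)) + (m : ℂ)⁻¹ • q := by abel
    have e2 : ‖(m : ℂ)⁻¹ • q‖ = (m : ℝ)⁻¹ * ‖q‖ := by
      rw [norm_smul, norm_inv, Complex.norm_natCast]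
    rw [e1]
    refine lt_of_le_of_lt (norm_add_le _ _) ?_
    rw [e2]
    linarith
  obtain ⟨⟨⟨k1, k2⟩, k3, k4⟩, k5⟩ := hball hpd
  let f : RatMap d := ⟨_, _, k3⟩
  let g : RatMap d := ⟨_, _, k4⟩
  have hfg : pairCoeffs f g = p := by
    funext x
    obtain ⟨i, j, l⟩ := x
    fin_cases i <;> fin_cases j <;> simp [pairCoeffs, f, g, half_apply]
  refine ⟨f, g, by rw [hfg]; exact hpΦ, Finset.univ.image (fun i => toP1 (H1 p (ζ i))), ?_, ?_⟩
  · rw [Finset.card_image_of_injective]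
    · simp
    · intro i j hij
      by_contra hne
      exact k5 i j hne (toP1_injective hij)
  · intro x hx
    rw [Finset.coe_image] at hx
    obtain ⟨i, -, rfl⟩ := hx
    refine ⟨preper_of_conj f 1 IsOfFinOrder.one (H1 p) (fun z => toFun_toP1 f _ _ (k1 z)) _ (hζf i), ?_⟩
    change toP1 (H1 p (ζ i)) ∈ Preper g
    rw [hp2 i]
    exact preper_of_conj g c hcf (H2 p) (fun z => toFun_toP1 g _ _ (k2 z)) _
      ((hζf i).mul (exp_finOrder (t i) m hm))
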